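/- The 3(g−1) quadratic monomials B⁻ = {x_i² : 0 ≤ i ≤ 2k} ∪ {x_ix_{i+1} : 0 ≤ i ≤ 2k−1} ∪ {x_ix_{i+k} : 1 ≤ i ≤ k−1} ∪ {x_ix_{i+k+1} : 0 ≤ i ≤ k−1}, regarded as elements of A, form a basis of V₂. -/

import Mathlib

set_option synthInstance.maxHeartbeats 400000
set_option maxHeartbeats 1000000

noncomputable section

open scoped TensorProduct

/-- The coordinate ring `A = ℂ[u,ε]/(ε²)` of the chart `U` of the balanced ribbon. -/
def A : Type := DualNumber (Polynomial ℂ)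

instance : CommRing A := inferInstanceAs (CommRing (DualNumber (Polynomial ℂ)))
instance : Algebra ℂ A := inferInstanceAs (Algebra ℂ (DualNumber (Polynomial ℂ)))

def uu : A := TrivSqZeroExt.inl Polynomial.X
def ee : A := DualNumber.eps

/-- The restrictions to `U` of the standard basis of `H⁰(ω)` of the balanced ribbon. -/
def x (k i : ℕ) : A :=
  if i ≤ k then uu ^ i else uu ^ i + ((i - k : ℕ) : A) * uu ^ (i - k - 1) * ee

/-- `V_m`: the span of the degree-`m` monomials in `x_0, …, x_{2k}`. -/
def V (k m : ℕ) : Submodule ℂ A :=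
  Submodule.span ℂ {a | ∃ f : Fin m → ℕ, (∀ j, f j ≤ 2 * k) ∧ a = ∏ j, x k (f j)}

/-- The family of `3(g−1) = 6k` quadratic monomials
`B⁻ = {x_i²}_{0 ≤ i ≤ 2k} ∪ {x_i x_{i+1}}_{0 ≤ i ≤ 2k−1} ∪ {x_i x_{i+k}}_{1 ≤ i ≤ k−1}
∪ {x_i x_{i+k+1}}_{0 ≤ i ≤ k−1}`. -/
def Bminus (k : ℕ) : Fin (2 * k + 1) ⊕ (Fin (2 * k) ⊕ (Fin (k - 1) ⊕ Fin k)) → A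
  | Sum.inl i => x k (i : ℕ) * x k (i : ℕ)
  | Sum.inr (Sum.inl i) => x k (i : ℕ) * x k ((i : ℕ) + 1)
  | Sum.inr (Sum.inr (Sum.inl i)) => x k ((i : ℕ) + 1) * x k ((i : ℕ) + 1 + k)
  | Sum.inr (Sum.inr (Sum.inr i)) => x k (i : ℕ) * x k ((i : ℕ) + k + 1)

theorem ee_mul_ee : ee * ee = 0 := DualNumber.eps_mul_eps

/-- The normal form `u ^ d + c u ^ (d - k - 1) ε` of a quadratic monomial of `u`-weight `d`. -/
def weightForm (k d c : ℕ) : A := uu ^ d + (c : A) * uu ^ (d - k - 1) * ee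

theorem x_mul_x (k i j : ℕ) : x k i * x k j = weightForm k (i + j) ((i - k) + (j - k)) := by
  have h := ee_mul_ee
  unfold x weightForm
  split_ifs with hi hj hj
  · simp [Nat.sub_eq_zero_of_le hi, Nat.sub_eq_zero_of_le hj, pow_add]
  · obtain ⟨m, rfl⟩ : ∃ m, j = k + 1 + m := ⟨j - (k + 1), by omega⟩
    rw [Nat.sub_eq_zero_of_le hi, show k + 1 + m - k = m + 1 by omega,
      show i + (k + 1 + m) - k - 1 = i + m by omega, show m + 1 - 1 = m by omega]
    push_cast
    ring
  · obtain ⟨m, rfl⟩ : ∃ m, i = k + 1 + m := ⟨i - (k + 1), by omega⟩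
    rw [Nat.sub_eq_zero_of_le hj, show k + 1 + m - k = m + 1 by omega,
      show k + 1 + m + j - k - 1 = m + j by omega, show m + 1 - 1 = m by omega]
    push_cast
    ring
  · obtain ⟨m, rfl⟩ : ∃ m, i = k + 1 + m := ⟨i - (k + 1), by omega⟩
    obtain ⟨n, rfl⟩ : ∃ n, j = k + 1 + n := ⟨j - (k + 1), by omega⟩
    rw [show k + 1 + m - k = m + 1 by omega, show k + 1 + n - k = n + 1 by omega,
      show k + 1 + m + (k + 1 + n) - k - 1 = k + 1 + m + n by omega,
      show m + 1 - 1 = m by omega, show n + 1 - 1 = n by omega]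
    push_cast
    linear_combination ((m : A) + 1) * (n + 1) * uu ^ m * uu ^ n * h

/-- The identification of `A` with the dual numbers over `ℂ[u]`. -/
def toDualNumber : A →ₐ[ℂ] DualNumber (Polynomial ℂ) :=
  AlgHom.id ℂ (DualNumber (Polynomial ℂ))

theorem toDualNumber_weightForm (k d c : ℕ) : toDualNumber (weightForm k d c) =
    TrivSqZeroExt.inl (Polynomial.X ^ d) +
      TrivSqZeroExt.inr ((c : Polynomial ℂ) * Polynomial.X ^ (d - k - 1)) := by
  have hu : toDualNumber uu = TrivSqZeroExt.inl Polynomial.X := rfl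
  have he : toDualNumber ee = DualNumber.eps := rfl
  rw [weightForm, map_add, map_mul, map_mul, map_pow, map_pow, map_natCast, hu, he,
    TrivSqZeroExt.inl_pow, TrivSqZeroExt.inl_pow]
  refine TrivSqZeroExt.ext ?_ ?_
  · simp only [DualNumber.eps, TrivSqZeroExt.fst_add, TrivSqZeroExt.fst_mul,
      TrivSqZeroExt.fst_inl, TrivSqZeroExt.fst_inr, mul_zero]
  · simp only [DualNumber.eps, TrivSqZeroExt.snd_add, TrivSqZeroExt.snd_mul,
      TrivSqZeroExt.snd_inl, TrivSqZeroExt.snd_inr, TrivSqZeroExt.fst_mul,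
      TrivSqZeroExt.fst_inl, TrivSqZeroExt.fst_inr, TrivSqZeroExt.fst_natCast,
      MulOpposite.op_zero, zero_smul, add_zero, smul_eq_mul, mul_one]

/-- The coefficient of `u ^ d` as a linear functional on `A`. -/
def fstCoeff (d : ℕ) : A →ₗ[ℂ] ℂ where
  toFun a := (toDualNumber a).fst.coeff d
  map_add' _ _ := by simp
  map_smul' _ _ := by simp

/-- The coefficient of `u ^ d ε` as a linear functional on `A`. -/
def sndCoeff (d : ℕ) : A →ₗ[ℂ] ℂ where
  toFun a := (toDualNumber a).snd.coeff d
  map_add' _ _ := by simp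
  map_smul' _ _ := by simp

theorem fstCoeff_weightForm (k d c n : ℕ) :
    fstCoeff n (weightForm k d c) = if n = d then 1 else 0 := by
  simp [fstCoeff, toDualNumber_weightForm, Polynomial.coeff_X_pow]

theorem sndCoeff_weightForm (k d c n : ℕ) :
    sndCoeff n (weightForm k d c) = if n = d - k - 1 then (c : ℂ) else 0 := by
  simp [sndCoeff, toDualNumber_weightForm, Polynomial.coeff_natCast_mul,
    Polynomial.coeff_X_pow]

theorem weightForm_mem_span {k d c₀ c₁ : ℕ} (hc : c₀ ≠ c₁) (c : ℕ) {S : Submodule ℂ A}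
    (h₀ : weightForm k d c₀ ∈ S) (h₁ : weightForm k d c₁ ∈ S) : weightForm k d c ∈ S := by
  have hne : (c₁ : ℂ) - c₀ ≠ 0 := sub_ne_zero.2 (by exact_mod_cast hc.symm)
  have key : weightForm k d c = ((c₁ - c : ℂ) / (c₁ - c₀)) • weightForm k d c₀ +
      ((c - c₀ : ℂ) / (c₁ - c₀)) • weightForm k d c₁ := by
    have e₁ : ((c₁ - c : ℂ) / (c₁ - c₀)) + ((c - c₀ : ℂ) / (c₁ - c₀)) = 1 := by
      field_simp
      ring
    have e₂ : ((c₁ - c : ℂ) / (c₁ - c₀)) * c₀ + ((c - c₀ : ℂ) / (c₁ - c₀)) * c₁ = c := by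
      field_simp
      ring
    generalize ((c₁ - c : ℂ) / (c₁ - c₀)) = a at *
    generalize ((c - c₀ : ℂ) / (c₁ - c₀)) = b at *
    replace e₁ := congrArg (algebraMap ℂ A) e₁
    replace e₂ := congrArg (algebraMap ℂ A) e₂
    simp only [map_add, map_mul, map_natCast, map_one] at e₁ e₂
    simp only [weightForm, Algebra.smul_def]
    linear_combination -uu ^ d * e₁ - uu ^ (d - k - 1) * ee * e₂
  rw [key]
  exact S.add_mem (S.smul_mem _ h₀) (S.smul_mem _ h₁)

/-- A family of normal forms is linearly independent if it splits into a part with distinct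
weights `d` and `ε`-coefficients `d - 2k`, and a part with distinct weights above `k` and other
`ε`-coefficients. -/
theorem linearIndependent_weightForm {ι : Type*} [Fintype ι] (k : ℕ) (d c : ι → ℕ) (E : Set ι)
    (hE : Set.InjOn d E) (hE' : Set.InjOn d Eᶜ) (hkE : ∀ i ∈ E, k < d i)
    (hcE : ∀ i ∈ E, c i ≠ d i - 2 * k) (hc : ∀ i ∉ E, c i = d i - 2 * k) :
    LinearIndependent ℂ fun i => weightForm k (d i) (c i) := by
  rw [Fintype.linearIndependent_iff]
  intro g hg
  have hgE : ∀ i ∈ E, g i = 0 := by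
    intro i hi
    have h := congrArg
      (sndCoeff (d i - k - 1) - ((d i - 2 * k : ℕ) : ℂ) • fstCoeff (d i)) hg
    rw [map_sum, map_zero, Finset.sum_eq_single i] at h
    · have hne : (c i : ℂ) - (d i - 2 * k : ℕ) ≠ 0 :=
        sub_ne_zero.2 (by exact_mod_cast hcE i hi)
      simpa [fstCoeff_weightForm, sndCoeff_weightForm, hne] using h
    · intro j _ hji
      have hki := hkE i hi
      by_cases hdj : d i = d j
      · have hjE : j ∉ E := fun hj => hji (hE hj hi hdj.symm)
        simp [fstCoeff_weightForm, sndCoeff_weightForm, hc j hjE, hdj]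
      · have : d i - k - 1 = d j - k - 1 → c j = 0 := by
          intro h
          have hjE : j ∉ E := fun hj => by have := hkE j hj; omega
          rw [hc j hjE]
          omega
        simp only [map_smul, LinearMap.sub_apply, LinearMap.smul_apply, fstCoeff_weightForm,
          sndCoeff_weightForm, if_neg hdj]
        split_ifs with h
        · simp [this h]
        · simp
    · simp
  intro i
  by_cases hi : i ∈ E
  · exact hgE i hi
  have h := congrArg (fstCoeff (d i)) hg
  rw [map_sum, map_zero, Finset.sum_eq_single i] at h
  · simpa [fstCoeff_weightForm] using h
  · intro j _ hji
    by_cases hj : j ∈ E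
    · simp [hgE j hj]
    · have : d i ≠ d j := fun h => hji (hE' hj hi h.symm)
      simp [fstCoeff_weightForm, this]
  · simp

/-- The `u`-weights of the monomials in `B⁻`. -/
def weight (k : ℕ) : Fin (2 * k + 1) ⊕ (Fin (2 * k) ⊕ (Fin (k - 1) ⊕ Fin k)) → ℕ
  | Sum.inl i => 2 * i
  | Sum.inr (Sum.inl i) => 2 * i + 1
  | Sum.inr (Sum.inr (Sum.inl i)) => 2 * i + k + 2
  | Sum.inr (Sum.inr (Sum.inr i)) => 2 * i + k + 1

/-- The `ε`-coefficients of the monomials in `B⁻`. -/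
def epsCoeff (k : ℕ) : Fin (2 * k + 1) ⊕ (Fin (2 * k) ⊕ (Fin (k - 1) ⊕ Fin k)) → ℕ
  | Sum.inl i => 2 * i - 2 * k
  | Sum.inr (Sum.inl i) => 2 * i + 1 - 2 * k
  | Sum.inr (Sum.inr (Sum.inl i)) => i + 1
  | Sum.inr (Sum.inr (Sum.inr i)) => i + 1

theorem Bminus_eq (k : ℕ) : Bminus k = fun i => weightForm k (weight k i) (epsCoeff k i) := by
  funext i
  rcases i with i | i | i | i <;> simp only [Bminus, x_mul_x, weight, epsCoeff] <;> congr 1 <;>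
    omega

theorem linearIndependent_Bminus (k : ℕ) : LinearIndependent ℂ (Bminus k) := by
  rw [Bminus_eq]
  refine linearIndependent_weightForm k _ _ {i | ∃ j, i = Sum.inr (Sum.inr j)} ?_ ?_ ?_ ?_ ?_
  · rintro _ ⟨i | i, rfl⟩ _ ⟨j | j, rfl⟩ h <;> simp only [weight] at h <;>
      first | omega | (congr; omega)
  · rintro (i | i | i) hi (j | j | j) hj h <;>
      first
        | (simp [-Sum.exists] at hi; done)
        | (simp [-Sum.exists] at hj; done)
        | skip
    all_goals simp only [weight] at h
    all_goals first | omega | (congr; omega)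
  · rintro _ ⟨i | i, rfl⟩ <;> simp only [weight] <;> omega
  · rintro _ ⟨i | i, rfl⟩ <;> simp only [weight, epsCoeff] <;> omega
  · rintro (i | i | i) hi
    · rfl
    · rfl
    · exact absurd ⟨i, rfl⟩ hi

theorem x_mul_x_mem_V (k : ℕ) {i j : ℕ} (hi : i ≤ 2 * k) (hj : j ≤ 2 * k) :
    x k i * x k j ∈ V k 2 :=
  Submodule.subset_span ⟨![i, j], by simp [Fin.forall_fin_two, hi, hj], by simp⟩

theorem x_mul_x_mem_span_Bminus (k : ℕ) {i j : ℕ} (hi : i ≤ 2 * k) (hj : j ≤ 2 * k) :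
    x k i * x k j ∈ Submodule.span ℂ (Set.range (Bminus k)) := by
  have hB : ∀ e, weightForm k (weight k e) (epsCoeff k e) ∈
      Submodule.span ℂ (Set.range (Bminus k)) := fun e =>
    Submodule.subset_span ⟨e, by rw [Bminus_eq]⟩
  rw [x_mul_x]
  have h₀ : weightForm k (i + j) (i + j - 2 * k) ∈ Submodule.span ℂ (Set.range (Bminus k)) := by
    obtain ⟨m, hm | hm⟩ := Nat.even_or_odd' (i + j)
    · rw [hm]
      exact hB (Sum.inl ⟨m, by omega⟩)
    · rw [hm]
      exact hB (Sum.inr (Sum.inl ⟨m, by omega⟩))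
  by_cases hd : k < i + j ∧ i + j < 3 * k
  · obtain ⟨m, hm | hm⟩ := Nat.even_or_odd' (i + j - k - 1)
    · refine weightForm_mem_span (c₁ := m + 1) (by omega) _ h₀ ?_
      rw [show i + j = 2 * m + k + 1 by omega]
      exact hB (Sum.inr (Sum.inr (Sum.inr ⟨m, by omega⟩)))
    · refine weightForm_mem_span (c₁ := m + 1) (by omega) _ h₀ ?_
      rw [show i + j = 2 * m + k + 2 by omega]
      exact hB (Sum.inr (Sum.inr (Sum.inl ⟨m, by omega⟩)))
  · rwa [show i - k + (j - k) = i + j - 2 * k by omega]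

/-- `B⁻` is a basis of `V₂ = H⁰(ω²)`. -/
theorem stmt_5 (k : ℕ) (hk : 2 ≤ k) :
    LinearIndependent ℂ (Bminus k) ∧ Submodule.span ℂ (Set.range (Bminus k)) = V k 2 := by
  refine ⟨linearIndependent_Bminus k, le_antisymm (Submodule.span_le.2 ?_)
    (Submodule.span_le.2 ?_)⟩
  · rintro _ ⟨i | i | i | i, rfl⟩ <;> exact x_mul_x_mem_V k (by omega) (by omega)
  · rintro _ ⟨f, hf, rfl⟩
    rw [Fin.prod_univ_two]
    exact x_mul_x_mem_span_Bminus k (hf 0) (hf 1)
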